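/- Let d ≥ 3, f ∈ 𝒮(ℝ^d; ℂ), ξ₀ ∈ ℝ^d \ {0}, and suppose min{|f(η)| : η ∈ B̄(0, 2|ξ₀|)} > 0. Then the maximal solution ξ^(0) of (d/dt) ξ^(0) = F^(0)(ξ^(0)), ξ^(0)(0) = ξ₀, is defined on all of [0, ∞), its norm is non-increasing, and ξ^(0)(t) → 0 as t → +∞. -/

import Mathlib

open MeasureTheory Filter Set
open scoped RealInnerProductSpace Topology ENNReal

noncomputable section

abbrev E (d : ℕ) := EuclideanSpace ℝ (Fin d)

/-- `g(η) = η |f(η)|²`. -/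
def gfun {d : ℕ} (f : SchwartzMap (E d) ℂ) (η : E d) : E d := ‖f η‖ ^ 2 • η

/-- the average `⨍_a^b u(σ) dσ`. -/
def intAvg {d : ℕ} (u : ℝ → E d) (a b : ℝ) : E d := (b - a)⁻¹ • ∫ σ in a..b, u σ

/-- `𝓕^(h)(u)(t)`; since `g` is real-valued, taking the real part of the complex
integral amounts to replacing `e^{-irθ}` by `cos (rθ)`. -/
def calF {d : ℕ} (f : SchwartzMap (E d) ℂ) (h : ℝ) (u : ℝ → E d) (t : ℝ) : E d :=
  (-2 : ℝ) • ∫ η, (∫ r in (0:ℝ)..(t / h),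
    Real.cos (r * (‖η‖ ^ 2 - 2 * ⟪η, intAvg u (t - h * r) t⟫))) • gfun f η

/-- the `i`-th component of the Fourier transform `ĝ(x) = (2π)^{-d/2} ∫ e^{-ix·η} g(η) dη`. -/
def ftGi {d : ℕ} (f : SchwartzMap (E d) ℂ) (i : Fin d) (x : E d) : ℂ :=
  ((2 * Real.pi) ^ (-(d : ℝ) / 2) : ℝ) *
    ∫ η, Complex.exp (-Complex.I * (⟪x, η⟫ : ℝ)) * ((gfun f η i : ℝ) : ℂ)

/-- `‖g‖_{L¹}`. -/
def L1g {d : ℕ} (f : SchwartzMap (E d) ℂ) : ℝ := ∫ η, ‖gfun f η‖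

/-- `‖ĝ‖_{L¹}` (with the euclidean norm of the complex vector `ĝ(x)`). -/
def L1ftg {d : ℕ} (f : SchwartzMap (E d) ℂ) : ℝ :=
  ∫ x, Real.sqrt (∑ i, ‖ftGi f i x‖ ^ 2)

/-- `C_g^1 = ‖g‖_{L¹} + (d/2 − 1) π^{d/2} ‖ĝ‖_{L¹}`. -/
def Cg1 {d : ℕ} (f : SchwartzMap (E d) ℂ) : ℝ :=
  L1g f + ((d : ℝ) / 2 - 1) * Real.pi ^ ((d : ℝ) / 2) * L1ftg f

/-- the inner integral `∫_{ℝ^d} e^{-ir(|η|²-2η·u)} g(η) dη` (the real part being taken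
componentwise, `e^{-irθ}` contributes `cos (rθ)` since `g` is real). -/
def F0inner {d : ℕ} (f : SchwartzMap (E d) ℂ) (r : ℝ) (u : E d) : E d :=
  ∫ η, Real.cos (r * (‖η‖ ^ 2 - 2 * ⟪η, u⟫)) • gfun f η

/-- `F^(0)(u) = −2 Re ∫_0^∞ (∫ e^{−ir(|η|²−2η·u)} η |f(η)|² dη) dr`, as the improper
integral in `r` (i.e. the limit of the integrals over `[0,R]` as `R → ∞`). -/
def F0pt {d : ℕ} (f : SchwartzMap (E d) ℂ) (u : E d) : E d :=
  limUnder atTop fun R : ℝ => ∫ r in (0:ℝ)..R, (-2 : ℝ) • F0inner f r u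


section Dissipative

variable {F : Type*} [NormedAddCommGroup F] [InnerProductSpace ℝ F]

theorem antitoneOn_norm_of_inner_nonpos {D : Set ℝ} (hD : Convex ℝ D) {ζ v : ℝ → F}
    (hζ : ∀ t ∈ D, HasDerivWithinAt ζ (v t) D t) (hv : ∀ t ∈ D, ⟪ζ t, v t⟫ ≤ 0) :
    AntitoneOn (fun t => ‖ζ t‖) D := by
  have h : AntitoneOn (fun t => ‖ζ t‖ ^ 2) D := by
    refine antitoneOn_of_hasDerivWithinAt_nonpos hD
      (fun t ht => (hζ t ht).norm_sq.continuousWithinAt)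
      (fun t ht => ((hζ t (interior_subset ht)).norm_sq).mono interior_subset) ?_
    intro t ht
    have := hv t (interior_subset ht)
    linarith
  intro a ha b hb hab
  exact (sq_le_sq₀ (norm_nonneg _) (norm_nonneg _)).1 (h ha hb hab)

theorem exists_forall_hasDerivWithinAt_Ici [CompleteSpace F] {V : F → F} {K L : NNReal}
    (hV : LipschitzWith K V) (hb : ∀ x, ‖V x‖ ≤ L) (x₀ : F) :
    ∃ ξ : ℝ → F, ξ 0 = x₀ ∧ ∀ t ∈ Ici (0 : ℝ), HasDerivWithinAt ξ (V (ξ t)) (Ici 0) t := by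
  have hex : ∀ T : NNReal, ∃ α : ℝ → F, α 0 = x₀ ∧
      ∀ t ∈ Icc (0 : ℝ) T, HasDerivWithinAt α (V (α t)) (Icc 0 (T : ℝ)) t := by
    intro T
    have hpl : IsPicardLindelof (fun _ => V) (tmin := 0) (tmax := T) ⟨0, le_rfl, T.2⟩ x₀
        (L * T) 0 L K := by
      refine ⟨fun t _ => hV.lipschitzOnWith, fun x _ => continuousOn_const,
        fun t _ x _ => hb x, ?_⟩
      simp
    simpa using hpl.exists_eq_forall_mem_Icc_hasDerivWithinAt₀
  choose α hα0 hα using hex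
  have hmem : ∀ {T : NNReal} {t : ℝ}, t ∈ Ico (0 : ℝ) T → Icc (0 : ℝ) T ∈ 𝓝[Ici 0] t := by
    intro T t ht
    rw [← Ici_inter_Iic]
    exact inter_mem self_mem_nhdsWithin (mem_nhdsWithin_of_mem_nhds (Iic_mem_nhds ht.2))
  have hder : ∀ {T : NNReal} {t : ℝ}, t ∈ Ico (0 : ℝ) T →
      HasDerivWithinAt (α T) (V (α T t)) (Ici 0) t := fun {T t} ht =>
    (hα T t ⟨ht.1, ht.2.le⟩).mono_of_mem_nhdsWithin (hmem ht)
  have hcompat : ∀ {S T : NNReal}, S ≤ T → EqOn (α S) (α T) (Icc (0 : ℝ) S) := by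
    intro S T hST
    have hST' : (S : ℝ) ≤ T := hST
    refine ODE_solution_unique (v := fun _ => V) (fun _ => hV)
      (fun t ht => (hα S t ht).continuousWithinAt)
      (fun t ht => (hder ht).mono (Ici_subset_Ici.2 ht.1))
      (fun t ht => ((hα T t ⟨ht.1, ht.2.trans hST'⟩).continuousWithinAt).mono
        (Icc_subset_Icc_right hST'))
      (fun t ht => (hder ⟨ht.1, ht.2.trans_le hST'⟩).mono (Ici_subset_Ici.2 ht.1)) ?_
    rw [hα0, hα0]
  have heq : ∀ {T : NNReal} {t : ℝ}, t ∈ Icc (0 : ℝ) T → α (Real.toNNReal t) t = α T t := by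
    intro T t ht
    exact hcompat (Real.toNNReal_le_iff_le_coe.2 ht.2) ⟨ht.1, Real.le_coe_toNNReal t⟩
  refine ⟨fun t => α (Real.toNNReal t) t, hα0 _, fun t ht => ?_⟩
  set T : NNReal := Real.toNNReal t + 1 with hT
  have htT : t ∈ Ico (0 : ℝ) T := by
    refine ⟨ht, ?_⟩
    have := Real.le_coe_toNNReal t
    rw [hT]; push_cast; linarith
  have hval : α (Real.toNNReal t) t = α T t := heq ⟨htT.1, htT.2.le⟩
  simp only [hval]
  exact (hder htT).congr_of_eventuallyEq
    (Filter.eventually_of_mem (hmem htT) fun s hs => heq hs) hval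

theorem tendsto_zero_of_inner_neg [FiniteDimensional ℝ F] {V : F → F} (hVc : Continuous V)
    {ξ : ℝ → F} (hξ : ∀ t ∈ Ici (0 : ℝ), HasDerivWithinAt ξ (V (ξ t)) (Ici 0) t)
    (hanti : AntitoneOn (fun t => ‖ξ t‖) (Ici 0))
    (hneg : ∀ x, x ≠ 0 → ‖x‖ ≤ ‖ξ 0‖ → ⟪x, V x⟫ < 0) :
    Tendsto ξ atTop (𝓝 0) := by
  have key : ∀ ε > 0, ∃ t ≥ (0 : ℝ), ‖ξ t‖ < ε := by
    intro ε hε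
    by_contra! hcon
    set A : Set F := {x | ε ≤ ‖x‖ ∧ ‖x‖ ≤ ‖ξ 0‖} with hA
    have hmem : ∀ t ∈ Ici (0 : ℝ), ξ t ∈ A := fun t ht =>
      ⟨hcon t ht, hanti self_mem_Ici ht ht⟩
    have hAc : IsCompact A := by
      refine (isCompact_closedBall (0 : F) ‖ξ 0‖).of_isClosed_subset ?_ ?_
      · exact (isClosed_le continuous_const continuous_norm).inter
          (isClosed_le continuous_norm continuous_const)
      · intro x hx
        simpa using hx.2
    obtain ⟨x, hxA, hx⟩ := hAc.exists_isMaxOn ⟨_, hmem 0 self_mem_Ici⟩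
      (continuous_id.inner hVc : Continuous fun x => ⟪x, V x⟫).continuousOn
    have hx0 : ⟪x, V x⟫ < 0 := hneg x (norm_pos_iff.1 (hε.trans_le hxA.1)) hxA.2
    set δ := -⟪x, V x⟫ with hδ
    have hδ0 : 0 < δ := by rw [hδ]; linarith
    have hdec : AntitoneOn (fun t => ‖ξ t‖ ^ 2 + 2 * δ * t) (Ici 0) := by
      refine antitoneOn_of_hasDerivWithinAt_nonpos (f' := fun t => 2 * ⟪ξ t, V (ξ t)⟫ + 2 * δ)
        (convex_Ici 0) ?_ ?_ ?_
      · exact fun t ht => ((hξ t ht).norm_sq.continuousWithinAt).add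
          (by fun_prop)
      · intro t ht
        have h1 := ((hξ t (interior_subset ht)).norm_sq).mono
          (interior_subset (s := Ici (0 : ℝ)))
        have h2 := ((hasDerivAt_id t).const_mul (2 * δ)).hasDerivWithinAt
          (s := interior (Ici (0 : ℝ)))
        simpa using! h1.add h2
      · intro t ht
        have := hx (hmem t (interior_subset ht))
        simp only [mem_ofPred_eq, id] at this
        linarith
    have hT : (0 : ℝ) ≤ (‖ξ 0‖ ^ 2 + 1) / (2 * δ) := by positivity
    have h := hdec self_mem_Ici (mem_Ici.2 hT) hT
    simp only [mul_zero, add_zero] at h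
    rw [mul_div_cancel₀ _ (by positivity)] at h
    nlinarith [sq_nonneg ‖ξ ((‖ξ 0‖ ^ 2 + 1) / (2 * δ))‖]
  rw [tendsto_zero_iff_norm_tendsto_zero, Metric.tendsto_atTop]
  intro ε hε
  obtain ⟨t, ht, h⟩ := key ε hε
  refine ⟨t, fun s hs => ?_⟩
  have : ‖ξ s‖ ≤ ‖ξ t‖ := hanti ht (mem_Ici.2 (ht.le.trans hs)) hs
  simpa using this.trans_lt h

theorem ne_zero_of_hasDerivWithinAt_Ici {V : F → F} {K : NNReal} (hV : LipschitzWith K V)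
    (hV0 : V 0 = 0) {ξ : ℝ → F}
    (hξ : ∀ t ∈ Ici (0 : ℝ), HasDerivWithinAt ξ (V (ξ t)) (Ici 0) t) (h0 : ξ 0 ≠ 0) :
    ∀ t ∈ Ici (0 : ℝ), ξ t ≠ 0 := by
  intro T hT hz
  refine h0 ?_
  refine ODE_solution_unique_of_mem_Icc_left (v := fun _ => V) (s := fun _ => univ)
    (K := K) (f := ξ) (g := fun _ => 0) (a := 0) (b := T)
    (fun t _ => hV.lipschitzOnWith) (fun t ht => ?_) (fun t ht => ?_) (fun _ _ => trivial)
    continuousOn_const (fun t _ => ?_) (fun _ _ => trivial) hz ⟨le_rfl, hT⟩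
  · exact (hξ t ht.1).continuousWithinAt.mono Icc_subset_Ici_self
  · exact ((hξ t (mem_Ici.2 ht.1.le)).hasDerivAt (Ici_mem_nhds ht.1)).hasDerivWithinAt
  · simp only [hV0]
    exact hasDerivWithinAt_const _ _ _

end Dissipative

section DirichletIntegral

theorem tendsto_integral_sin_mul_atTop {k : ℝ → ℝ} (hk : Integrable k) :
    Tendsto (fun R : ℝ => ∫ x, Real.sin (R * x) * k x) atTop (𝓝 0) := by
  have h := Real.tendsto_integral_exp_smul_cocompact (fun x => (k x : ℂ))
  have hR : Tendsto (fun R : ℝ => R / (2 * Real.pi)) atTop (cocompact ℝ) :=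
    (tendsto_id.atTop_div_const (by positivity)).mono_right atTop_le_cocompact
  have h2 := ((Complex.continuous_im.tendsto _).comp (h.comp hR)).neg
  rw [Complex.zero_im, neg_zero] at h2
  refine h2.congr fun R => ?_
  have hchar : ∀ v : ℝ, (Real.fourierChar (-(v * (R / (2 * Real.pi)))) : Circle) • (k v : ℂ) =
      Complex.exp ((-(R * v) : ℝ) * Complex.I) * (k v : ℂ) := by
    intro v
    rw [Circle.smul_def, Real.fourierChar_apply, smul_eq_mul]
    have : 2 * Real.pi * -(v * (R / (2 * Real.pi))) = -(R * v) := by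
      field_simp
    rw [this]
  have h_int : Integrable fun v : ℝ => Complex.exp ((-(R * v) : ℝ) * Complex.I) * (k v : ℂ) :=
    hk.ofReal.bdd_mul (c := 1) (by fun_prop)
      (ae_of_all _ fun v => (Complex.norm_exp_ofReal_mul_I _).le)
  have := Complex.imCLM.integral_comp_comm h_int
  simp only [Complex.imCLM_apply, Complex.im_mul_ofReal, Complex.exp_ofReal_mul_I_im,
    Real.sin_neg] at this
  simp only [Function.comp, hchar]
  rw [← this, ← integral_neg]
  simp

theorem integral_cos_mul_exp_neg_sq (r : ℝ) :
    ∫ x : ℝ, Real.cos (r * x) * Real.exp (-x ^ 2) =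
      √Real.pi * Real.exp (-(1 / 4) * r ^ 2) := by
  have h := fourierIntegral_gaussian (b := 1) (by simp) (r : ℂ)
  have h_int : Integrable fun x : ℝ =>
      Complex.exp (Complex.I * r * x) * Complex.exp (-1 * (x : ℂ) ^ 2) := by
    have h1 := GaussianFourier.integrable_cexp_neg_mul_sq_add_real_mul_I (b := 1) (by simp) 0
    refine (h1.bdd_mul (f := fun x : ℝ => Complex.exp (Complex.I * r * x)) (c := 1)
      (by fun_prop) (ae_of_all _ fun x => ?_)).congr (ae_of_all _ fun _ => by simp)
    have : Complex.I * r * x = ((r * x : ℝ) : ℂ) * Complex.I := by push_cast; ring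
    rw [this, Complex.norm_exp_ofReal_mul_I]
  have h2 := Complex.reCLM.integral_comp_comm h_int
  rw [h] at h2
  have hpow : (Real.pi / 1 : ℂ) ^ (1 / 2 : ℂ) = (√Real.pi : ℝ) := by
    rw [Real.sqrt_eq_rpow, Complex.ofReal_cpow Real.pi_pos.le]
    simp
  rw [hpow] at h2
  have hexp : Complex.exp (-(r : ℂ) ^ 2 / (4 * 1)) = (Real.exp (-(1 / 4) * r ^ 2) : ℝ) := by
    push_cast
    congr 1
    ring
  rw [hexp, ← Complex.ofReal_mul] at h2
  simp only [Complex.reCLM_apply, Complex.ofReal_re] at h2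
  rw [← h2]
  congr 1 with x
  have e1 : Complex.I * r * x = ((r * x : ℝ) : ℂ) * Complex.I := by push_cast; ring
  have e2 : (-1 * (x : ℂ) ^ 2) = ((-x ^ 2 : ℝ) : ℂ) := by push_cast; ring
  rw [e1, e2, ← Complex.ofReal_exp, Complex.re_mul_ofReal, Complex.exp_ofReal_mul_I_re]

theorem tendsto_intervalIntegral_integral_cos_mul_exp_neg_sq :
    Tendsto (fun R : ℝ => ∫ r in (0 : ℝ)..R, ∫ x : ℝ, Real.cos (r * x) * Real.exp (-x ^ 2))
      atTop (𝓝 Real.pi) := by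
  simp only [integral_cos_mul_exp_neg_sq]
  have hi : IntegrableOn (fun r : ℝ => √Real.pi * Real.exp (-(1 / 4) * r ^ 2)) (Ioi 0) :=
    ((integrable_exp_neg_mul_sq (by norm_num)).const_mul _).integrableOn
  have h := intervalIntegral_tendsto_integral_Ioi 0 hi tendsto_id
  rw [integral_const_mul, integral_gaussian_Ioi] at h
  have : √Real.pi * (√(Real.pi / (1 / 4)) / 2) = Real.pi := by
    have h4 : Real.pi / (1 / 4) = 2 ^ 2 * Real.pi := by ring
    rw [h4, Real.sqrt_mul (by norm_num), Real.sqrt_sq (by norm_num)]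
    have := Real.mul_self_sqrt Real.pi_pos.le
    linarith
  rw [this] at h
  exact h

theorem integrable_cos_mul {α : Type*} [MeasurableSpace α] {μ : Measure α} {θ k : α → ℝ}
    (hθ : Measurable θ) (hk : Integrable k μ) :
    Integrable (fun x => Real.cos (θ x) * k x) μ :=
  hk.bdd_mul (c := 1) (Real.measurable_cos.comp hθ).aestronglyMeasurable
    (ae_of_all _ fun _ => Real.abs_cos_le_one _)

theorem intervalIntegrable_integral_cos_mul {α : Type*} [MeasurableSpace α] {μ : Measure α}
    {θ k : α → ℝ} (hθ : Measurable θ) (hk : Integrable k μ) (R : ℝ) :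
    IntervalIntegrable (fun r => ∫ x, Real.cos (r * θ x) * k x ∂μ) volume 0 R := by
  refine Continuous.intervalIntegrable ?_ _ _
  refine continuous_of_dominated (bound := fun x => |k x|)
    (fun r => (integrable_cos_mul (hθ.const_mul r) hk).aestronglyMeasurable)
    (fun r => ae_of_all _ fun x => ?_) hk.abs (ae_of_all _ fun x => by fun_prop)
  rw [Real.norm_eq_abs, abs_mul]
  exact mul_le_of_le_one_left (abs_nonneg _) (Real.abs_cos_le_one _)

theorem intervalIntegral_integral_cos_mul_id {k : ℝ → ℝ}
    (hk : Integrable fun x => x * k x) {R : ℝ} (hR : 0 ≤ R) :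
    ∫ r in (0 : ℝ)..R, ∫ x, Real.cos (r * x) * (x * k x) = ∫ x, Real.sin (R * x) * k x := by
  rw [intervalIntegral.integral_of_le hR, integral_integral_swap]
  · congr 1 with x
    rw [← intervalIntegral.integral_of_le hR, intervalIntegral.integral_mul_const]
    rcases eq_or_ne x 0 with rfl | hx
    · simp
    · rw [intervalIntegral.integral_comp_mul_right _ hx]
      simp only [zero_mul, integral_cos, Real.sin_zero, sub_zero, smul_eq_mul]
      field_simp
  · have h : Integrable (fun p : ℝ × ℝ => p.2 * k p.2)
        ((volume.restrict (Ioc 0 R)).prod volume) := hk.comp_snd _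
    exact integrable_cos_mul (θ := fun p : ℝ × ℝ => p.1 * p.2) (by fun_prop) h

theorem integrable_div_id {φ : ℝ → ℝ} (hφ : Integrable φ)
    (h0 : φ =O[𝓝 0] fun x => x) : Integrable fun x => φ x / x := by
  obtain ⟨C, hC⟩ := h0.bound
  obtain ⟨δ, hδ, hball⟩ := Metric.eventually_nhds_iff.1 hC
  have hdom : Integrable fun x => |φ x| / δ + (Metric.ball (0 : ℝ) δ).indicator (fun _ => |C|) x :=
    (hφ.abs.div_const δ).add
      ((integrable_indicator_iff Metric.isOpen_ball.measurableSet).2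
        (integrableOn_const Metric.isBounded_ball.measure_lt_top.ne))
  refine hdom.mono' (hφ.aestronglyMeasurable.div₀ (by fun_prop)) (ae_of_all _ fun x => ?_)
  rw [norm_div, Real.norm_eq_abs, Real.norm_eq_abs]
  by_cases hx : x ∈ Metric.ball (0 : ℝ) δ
  · rw [indicator_of_mem hx]
    have h1 := hball hx
    rw [Real.norm_eq_abs, Real.norm_eq_abs] at h1
    have h2 : |φ x| / |x| ≤ |C| :=
      div_le_of_le_mul₀ (abs_nonneg _) (abs_nonneg _)
        (h1.trans (mul_le_mul_of_nonneg_right (le_abs_self C) (abs_nonneg x)))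
    have h3 : 0 ≤ |φ x| / δ := by positivity
    linarith
  · rw [indicator_of_notMem hx, add_zero]
    have : δ ≤ |x| := by simpa using hx
    gcongr

theorem tendsto_intervalIntegral_integral_cos_mul {h : ℝ → ℝ} {a : ℝ} (hi : Integrable h)
    (ha : (fun x => h (a + x) - h a) =O[𝓝 0] fun x => x) :
    Tendsto (fun R : ℝ => ∫ r in (0 : ℝ)..R, ∫ y, Real.cos (r * (y - a)) * h y)
      atTop (𝓝 (Real.pi * h a)) := by
  set φ : ℝ → ℝ := fun x => h (a + x) - h a * Real.exp (-x ^ 2) with hφ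
  have hga : Integrable fun x : ℝ => Real.exp (-x ^ 2) := by
    simpa using integrable_exp_neg_mul_sq (b := 1) one_pos
  have hφi : Integrable φ := (hi.comp_add_left a).sub (hga.const_mul _)
  have hφO : φ =O[𝓝 0] fun x => x := by
    have hd : HasDerivAt (fun x : ℝ => h a * Real.exp (-x ^ 2))
        (h a * (Real.exp (-0 ^ 2) * (-(2 * 0)))) 0 := by
      have := (((hasDerivAt_pow 2 (0 : ℝ)).neg).exp).const_mul (h a)
      simpa using! this
    have h2 := hd.isBigO_sub
    simp only [sub_zero] at h2
    refine (ha.sub h2).congr_left fun x => ?_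
    simp [hφ]
  have hki := integrable_div_id hφi hφO
  have hφ0 : φ 0 = 0 := by simp [hφ]
  have hxk : (fun x => x * (φ x / x)) = φ := by
    ext x
    rcases eq_or_ne x 0 with rfl | hx
    · simp [hφ0]
    · field_simp
  have hlim := (tendsto_integral_sin_mul_atTop hki).add
    (tendsto_intervalIntegral_integral_cos_mul_exp_neg_sq.const_mul (h a))
  rw [zero_add, mul_comm] at hlim
  refine hlim.congr' ?_
  filter_upwards [eventually_ge_atTop 0] with R hR
  rw [← intervalIntegral_integral_cos_mul_id (by rwa [hxk]) hR]
  rw [← intervalIntegral.integral_const_mul, ← intervalIntegral.integral_add]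
  · congr 1 with r
    rw [← integral_const_mul, ← integral_add]
    · rw [← integral_add_left_eq_self (fun y => Real.cos (r * (y - a)) * h y) a]
      congr 1 with x
      rw [congrFun hxk x]
      simp only [hφ, add_sub_cancel_left]
      ring
    · exact integrable_cos_mul (by fun_prop) (by rwa [hxk])
    · exact (integrable_cos_mul (by fun_prop) hga).const_mul _
  · exact intervalIntegrable_integral_cos_mul measurable_id (by rwa [hxk]) R
  · exact (intervalIntegrable_integral_cos_mul measurable_id hga R).const_mul _

end DirichletIntegral

section SphericalMeans

open Module (finrank)

variable {V : Type*} [NormedAddCommGroup V] [InnerProductSpace ℝ V] [FiniteDimensional ℝ V]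
  [Nontrivial V] [MeasurableSpace V] [BorelSpace V] (μ : Measure V) [μ.IsAddHaarMeasure]

theorem integral_eq_integral_Ioi_sphere {g : V → ℝ} (hg : Integrable g μ) :
    IntegrableOn (fun s : ℝ => s ^ (finrank ℝ V - 1) * ∫ ω, g (s • (ω : V)) ∂μ.toSphere) (Ioi 0) ∧
    ∫ y, g y ∂μ =
      ∫ s in Ioi (0 : ℝ), s ^ (finrank ℝ V - 1) * ∫ ω, g (s • (ω : V)) ∂μ.toSphere := by
  have hp := μ.measurePreserving_homeomorphUnitSphereProd
  have he := (homeomorphUnitSphereProd V).measurableEmbedding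
  set G : Metric.sphere (0 : V) 1 × Ioi (0 : ℝ) → ℝ := fun p => g ((p.2 : ℝ) • (p.1 : V)) with hG
  have hcomp : ∀ x : ({0}ᶜ : Set V), G (homeomorphUnitSphereProd V x) = g x := by
    rintro ⟨x, hx⟩
    have : ‖x‖ ≠ 0 := norm_ne_zero_iff.2 hx
    simp [hG, smul_smul, this]
  have hi : Integrable G (μ.toSphere.prod (Measure.volumeIoiPow (finrank ℝ V - 1))) := by
    rw [← hp.integrable_comp_emb he]
    have : G ∘ homeomorphUnitSphereProd V = g ∘ (↑) := funext hcomp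
    rw [this, ← integrableOn_iff_comap_subtypeVal (measurableSet_singleton _).compl]
    exact hg.integrableOn
  have hdens : Measurable fun r : Ioi (0 : ℝ) => Real.toNNReal (r.1 ^ (finrank ℝ V - 1)) :=
    (measurable_subtype_coe.pow_const _).real_toNNReal
  have hsmul : ∀ s : Ioi (0 : ℝ), ∀ c : ℝ,
      Real.toNNReal ((s : ℝ) ^ (finrank ℝ V - 1)) • c = (s : ℝ) ^ (finrank ℝ V - 1) * c := by
    intro s c
    rw [NNReal.smul_def, Real.coe_toNNReal _ (pow_nonneg s.2.out.le _), smul_eq_mul]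
  constructor
  · have h1 := hi.integral_prod_right
    rw [Measure.volumeIoiPow] at h1
    have h2 := (integrable_withDensity_iff_integrable_smul (μ := Measure.comap Subtype.val volume)
      hdens).1 h1
    simp only [hsmul] at h2
    rwa [integrableOn_iff_comap_subtypeVal measurableSet_Ioi]
  · calc ∫ y, g y ∂μ = ∫ x : ({0}ᶜ : Set V), g x ∂(μ.comap (↑)) := by
          rw [integral_subtype_comap (measurableSet_singleton _).compl fun x => g x,
            restrict_compl_singleton]
      _ = ∫ p, G p ∂(μ.toSphere.prod (Measure.volumeIoiPow (finrank ℝ V - 1))) := by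
          rw [← hp.integral_comp he]
          exact integral_congr_ae (ae_of_all _ fun x => (hcomp x).symm)
      _ = ∫ s, ∫ ω, G (ω, s) ∂μ.toSphere ∂(Measure.volumeIoiPow (finrank ℝ V - 1)) :=
          integral_prod_symm _ hi
      _ = _ := by
          simp only [Measure.volumeIoiPow, ENNReal.ofReal]
          rw [integral_withDensity_eq_integral_smul hdens]
          simp only [hsmul, hG]
          rw [integral_subtype_comap measurableSet_Ioi
            fun s : ℝ => s ^ (finrank ℝ V - 1) * ∫ ω, g (s • (ω : V)) ∂μ.toSphere]

omit [Nontrivial V] in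
theorem isBigO_sphere_integral_sqrt {g : V → ℝ} (hg : ContDiff ℝ 1 g) (u : V) {a : ℝ}
    (ha : 0 < a) :
    (fun x : ℝ => (∫ ω, g (u + √(a + x) • (ω : V)) ∂μ.toSphere) -
      ∫ ω, g (u + √a • (ω : V)) ∂μ.toSphere) =O[𝓝 0] fun x => x := by
  obtain ⟨K, hK⟩ := hg.contDiffOn.exists_lipschitzOnWith one_ne_zero
    (convex_closedBall u (√a + 1)) (isCompact_closedBall u (√a + 1))
  have hsq : HasDerivAt (fun x : ℝ => √(a + x)) (1 / (2 * √(a + 0))) 0 := by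
    simpa using (((hasDerivAt_id (0 : ℝ)).const_add a).sqrt (by simpa using ha.ne'))
  have hO := hsq.isBigO_sub
  simp only [add_zero, sub_zero] at hO
  refine Asymptotics.IsBigO.trans (Asymptotics.IsBigO.of_bound
    (K * μ.toSphere.real univ) ?_) hO
  have hev : ∀ᶠ x : ℝ in 𝓝 0, √(a + x) < √a + 1 := by
    have : Tendsto (fun x : ℝ => √(a + x)) (𝓝 0) (𝓝 √a) := by
      simpa using hsq.continuousAt.tendsto
    exact this.eventually (gt_mem_nhds (by linarith))
  have h_int : ∀ s : ℝ, Integrable (fun ω : Metric.sphere (0 : V) 1 => g (u + s • (ω : V)))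
      μ.toSphere := fun s =>
    (hg.continuous.comp (by fun_prop)).integrable_of_hasCompactSupport
      (HasCompactSupport.of_compactSpace _)
  filter_upwards [hev] with x hx
  rw [← integral_sub (h_int _) (h_int _)]
  have hmem : ∀ s : ℝ, 0 ≤ s → s ≤ √a + 1 → ∀ ω : Metric.sphere (0 : V) 1,
      u + s • (ω : V) ∈ Metric.closedBall u (√a + 1) := by
    intro s hs hs' ω
    simpa [norm_smul, abs_of_nonneg hs] using hs'
  refine (norm_integral_le_of_norm_le_const (ae_of_all _ fun ω => ?_)).trans_eq
    (mul_right_comm _ _ _)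
  refine (hK.norm_sub_le (hmem _ (Real.sqrt_nonneg _) hx.le ω)
    (hmem _ (Real.sqrt_nonneg _) (by linarith) ω)).trans_eq ?_
  rw [add_sub_add_left_eq_sub, ← sub_smul, norm_smul]
  simp

theorem tendsto_integral_cos_sphere {g : V → ℝ} (hg : ContDiff ℝ 1 g) (hi : Integrable g μ)
    {n : ℕ} (hn : finrank ℝ V = n + 2) {u : V} (hu : u ≠ 0) :
    Tendsto (fun R : ℝ => ∫ r in (0 : ℝ)..R,
      ∫ η, Real.cos (r * (‖η‖ ^ 2 - 2 * ⟪η, u⟫)) * g η ∂μ) atTop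
      (𝓝 (Real.pi * (1 / 2 * ‖u‖ ^ n * ∫ ω, g (u + ‖u‖ • (ω : V)) ∂μ.toSphere))) := by
  set a := ‖u‖ ^ 2 with ha
  have hupos : 0 < ‖u‖ := norm_pos_iff.2 hu
  have ha0 : 0 < a := by positivity
  have hsa : √a = ‖u‖ := Real.sqrt_sq hupos.le
  set B : ℝ → ℝ := fun τ => 1 / 2 * √τ ^ n * ∫ ω, g (u + √τ • (ω : V)) ∂μ.toSphere with hB
  set h : ℝ → ℝ := (Ioi 0).indicator B with hh
  have hiu : Integrable (fun y => g (u + y)) μ := hi.comp_add_left u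
  have hsub : ∀ c : ℝ → ℝ, ∀ s ∈ Ioi (0 : ℝ), (2 * s ^ ((2 : ℝ) - 1)) • (c (s ^ (2 : ℝ)) *
      B (s ^ (2 : ℝ))) = s ^ (finrank ℝ V - 1) *
        ∫ ω, c (‖s • (ω : V)‖ ^ 2) * g (u + s • (ω : V)) ∂μ.toSphere := by
    intro c s hs
    have hs0 : (0 : ℝ) < s := hs
    have hnorm : ∀ ω : Metric.sphere (0 : V) 1, ‖s • (ω : V)‖ = s := fun ω => by
      simp [norm_smul, abs_of_pos hs0]
    simp only [hnorm, hB, Real.rpow_two, Real.sqrt_sq hs0.le, integral_const_mul, smul_eq_mul]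
    rw [hn, show (2 : ℝ) - 1 = 1 by norm_num, Real.rpow_one, show n + 2 - 1 = n + 1 by rfl]
    ring
  have hBi : IntegrableOn B (Ioi 0) := by
    rw [← integrableOn_Ioi_comp_rpow_iff B two_ne_zero]
    refine (integral_eq_integral_Ioi_sphere μ hiu).1.congr_fun (fun s hs => ?_) measurableSet_Ioi
    have := hsub (fun _ => 1) s hs
    simp only [one_mul] at this
    simp only [← this, abs_two]
  have hhi : Integrable h := (integrable_indicator_iff measurableSet_Ioi).2 hBi
  have hha : h a = B a := indicator_of_mem (mem_Ioi.2 ha0) _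
  have hO : (fun x => h (a + x) - h a) =O[𝓝 0] fun x => x := by
    have hd : HasDerivAt (fun x : ℝ => 1 / 2 * √(a + x) ^ n)
        (1 / 2 * (n * √(a + 0) ^ (n - 1) * (1 / (2 * √(a + 0))))) 0 := by
      have : HasDerivAt (fun x : ℝ => √(a + x)) (1 / (2 * √(a + 0))) 0 := by
        simpa using (((hasDerivAt_id (0 : ℝ)).const_add a).sqrt (by simpa using ha0.ne'))
      exact (this.pow n).const_mul _
    have h1 := hd.isBigO_sub
    have h2 := isBigO_sphere_integral_sqrt μ hg u ha0
    have h3 := hd.continuousAt.tendsto.isBigO_one ℝ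
    have h4 := h3.mul h2
    simp only [one_mul] at h4
    simp only [add_zero, sub_zero] at h1
    have h5 := h4.add (h1.const_mul_left (∫ ω, g (u + √a • (ω : V)) ∂μ.toSphere))
    refine h5.congr' ?_ EventuallyEq.rfl
    filter_upwards [lt_mem_nhds (neg_lt_zero.2 ha0)] with x hx
    have hax : a + x ∈ Ioi (0 : ℝ) := mem_Ioi.2 (by linarith)
    rw [hha, hh, indicator_of_mem hax, hB]
    ring
  have hlim := tendsto_intervalIntegral_integral_cos_mul hhi hO
  rw [hha, hB] at hlim
  simp only [hsa] at hlim
  refine hlim.congr fun R => ?_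
  congr 1 with r
  have hc : Integrable (fun y => Real.cos (r * (‖y‖ ^ 2 - a)) * g (u + y)) μ :=
    integrable_cos_mul (by fun_prop) hiu
  have hleft : ∀ y, Real.cos (r * (y - a)) * h y =
      (Ioi 0).indicator (fun y => Real.cos (r * (y - a)) * B y) y := by
    intro y
    by_cases hy : y ∈ Ioi (0 : ℝ)
    · simp only [hh, indicator_of_mem hy]
    · simp only [hh, indicator_of_notMem hy, mul_zero]
  simp only [hleft]
  rw [integral_indicator measurableSet_Ioi, ← integral_comp_rpow_Ioi_of_pos two_pos,
    setIntegral_congr_fun measurableSet_Ioi (hsub fun y => Real.cos (r * (y - a))),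
    ← (integral_eq_integral_Ioi_sphere μ hc).2,
    ← integral_add_left_eq_self (fun η => Real.cos (r * (‖η‖ ^ 2 - 2 * ⟪η, u⟫)) * g η) u]
  congr 1 with y
  congr 3
  rw [norm_add_sq_real, inner_add_left, real_inner_self_eq_norm_sq, real_inner_comm]
  ring

end SphericalMeans

section SphericalField

variable {V : Type*} [NormedAddCommGroup V] [InnerProductSpace ℝ V] [FiniteDimensional ℝ V]
  [MeasurableSpace V] [BorelSpace V]

/-- The vector field `u ↦ -π ∫_{S} w(|u|, u + |u| ω) (u + |u| ω) dω`, an average over the sphere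
of radius `|u|` centred at `u`. -/
def sphericalField (w : ℝ × V → ℝ) (u : V) : V :=
  (-Real.pi) • ∫ ω, w (‖u‖, u + ‖u‖ • (ω : V)) • (u + ‖u‖ • (ω : V))
    ∂(volume : Measure V).toSphere

theorem integrable_toSphere_of_continuous {G : Type*} [NormedAddCommGroup G]
    {φ : Metric.sphere (0 : V) 1 → G} (hφ : Continuous φ) :
    Integrable φ (volume : Measure V).toSphere :=
  hφ.integrable_of_hasCompactSupport (HasCompactSupport.of_compactSpace _)

theorem sphericalField_zero (w : ℝ × V → ℝ) : sphericalField w 0 = 0 := by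
  simp [sphericalField]

omit [FiniteDimensional ℝ V] [MeasurableSpace V] [BorelSpace V] in
theorem norm_add_norm_smul_sphere_le (u : V) (ω : Metric.sphere (0 : V) 1) :
    ‖u + ‖u‖ • (ω : V)‖ ≤ 2 * ‖u‖ := by
  refine (norm_add_le _ _).trans_eq ?_
  simp [norm_smul]
  ring

omit [FiniteDimensional ℝ V] [MeasurableSpace V] [BorelSpace V] in
theorem inner_add_norm_smul_sphere_nonneg (u : V) (ω : Metric.sphere (0 : V) 1) :
    0 ≤ ⟪u, u + ‖u‖ • (ω : V)⟫ := by
  rw [inner_add_right, inner_smul_right, real_inner_self_eq_norm_sq]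
  have h := (abs_le.1 (abs_real_inner_le_norm u (ω : V))).1
  rw [norm_eq_of_mem_sphere, mul_one] at h
  nlinarith [norm_nonneg u]

theorem inner_sphericalField {w : ℝ × V → ℝ} (hw : Continuous w) (u : V) :
    ⟪u, sphericalField w u⟫ = -Real.pi * ∫ ω, w (‖u‖, u + ‖u‖ • (ω : V)) *
      ⟪u, u + ‖u‖ • (ω : V)⟫ ∂(volume : Measure V).toSphere := by
  rw [sphericalField, inner_smul_right, ← integral_inner]
  · simp only [inner_smul_right]
  · exact integrable_toSphere_of_continuous (by fun_prop)

theorem inner_sphericalField_nonpos {w : ℝ × V → ℝ} (hw : Continuous w)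
    (hw0 : ∀ p, 0 ≤ p.1 → 0 ≤ w p) (u : V) :
    ⟪u, sphericalField w u⟫ ≤ 0 := by
  rw [inner_sphericalField hw]
  have : 0 ≤ ∫ ω, w (‖u‖, u + ‖u‖ • (ω : V)) * ⟪u, u + ‖u‖ • (ω : V)⟫
      ∂(volume : Measure V).toSphere :=
    integral_nonneg fun ω => mul_nonneg (hw0 _ (norm_nonneg u))
      (inner_add_norm_smul_sphere_nonneg u ω)
  nlinarith [Real.pi_pos]

theorem inner_sphericalField_neg {w : ℝ × V → ℝ} (hw : Continuous w)
    (hw0 : ∀ p, 0 ≤ p.1 → 0 ≤ w p) {u : V}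
    (hu : u ≠ 0) (hpos : 0 < w (‖u‖, (2 : ℝ) • u)) : ⟪u, sphericalField w u⟫ < 0 := by
  rw [inner_sphericalField hw]
  have hn : ‖u‖ ≠ 0 := norm_ne_zero_iff.2 hu
  set ω₀ : Metric.sphere (0 : V) 1 := ⟨‖u‖⁻¹ • u, by simp [norm_smul, hn]⟩ with hω₀
  have h2 : u + ‖u‖ • (ω₀ : V) = (2 : ℝ) • u := by
    rw [hω₀, smul_smul, mul_inv_cancel₀ hn, one_smul, two_smul]
  have : 0 < ∫ ω, w (‖u‖, u + ‖u‖ • (ω : V)) * ⟪u, u + ‖u‖ • (ω : V)⟫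
      ∂(volume : Measure V).toSphere := by
    refine Continuous.integral_pos_of_hasCompactSupport_nonneg_nonzero (x := ω₀) (by fun_prop)
      (HasCompactSupport.of_compactSpace _)
      (fun ω => mul_nonneg (hw0 _ (norm_nonneg u)) (inner_add_norm_smul_sphere_nonneg u ω)) ?_
    rw [h2, inner_smul_right, real_inner_self_eq_norm_sq]
    positivity
  nlinarith [Real.pi_pos]

theorem exists_lipschitzWith_sphericalField {w : ℝ × V → ℝ} (hw : ContDiff ℝ 1 w)
    (hc : HasCompactSupport w) :
    ∃ K L : NNReal, LipschitzWith K (sphericalField w) ∧ ∀ u, ‖sphericalField w u‖ ≤ L := by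
  set Ψ : ℝ × V → V := fun p => w p • p.2 with hΨ
  have hΨd : ContDiff ℝ 1 Ψ := hw.smul contDiff_snd
  have hΨc : HasCompactSupport Ψ := hc.smul_right
  obtain ⟨C, hC⟩ := hΨd.lipschitzWith_of_hasCompactSupport hΨc one_ne_zero
  obtain ⟨M, hM⟩ := hΨc.exists_bound_of_continuous hΨd.continuous
  have hΨcont := hΨd.continuous
  set S := (volume : Measure V).toSphere.real univ with hS
  have hM0 : 0 ≤ M := (norm_nonneg _).trans (hM 0)
  refine ⟨Real.toNNReal (Real.pi * (C * 2 * S)), Real.toNNReal (Real.pi * (M * S)),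
    LipschitzWith.of_dist_le_mul fun u v => ?_, fun u => ?_⟩
  · rw [Real.coe_toNNReal _ (by positivity), dist_eq_norm, dist_eq_norm, sphericalField,
      sphericalField, ← smul_sub, ← integral_sub
        (integrable_toSphere_of_continuous (by fun_prop))
        (integrable_toSphere_of_continuous (by fun_prop)), norm_smul, norm_neg, Real.norm_eq_abs,
      abs_of_pos Real.pi_pos, mul_assoc]
    refine mul_le_mul_of_nonneg_left ?_ Real.pi_pos.le
    refine (norm_integral_le_of_norm_le_const (C := C * 2 * ‖u - v‖)
      (ae_of_all _ fun ω => ?_)).trans_eq (by ring)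
    refine (hC.norm_sub_le (‖u‖, u + ‖u‖ • (ω : V)) (‖v‖, v + ‖v‖ • (ω : V))).trans ?_
    rw [mul_assoc]
    refine mul_le_mul_of_nonneg_left ?_ C.2
    have h1 : |‖u‖ - ‖v‖| ≤ ‖u - v‖ := abs_norm_sub_norm_le u v
    rw [Prod.mk_sub_mk, Prod.norm_mk]
    refine max_le ?_ ?_
    · rw [Real.norm_eq_abs]
      linarith [norm_nonneg (u - v)]
    · rw [add_sub_add_comm, ← sub_smul]
      refine (norm_add_le _ _).trans ?_
      rw [norm_smul, norm_eq_of_mem_sphere, mul_one, Real.norm_eq_abs]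
      linarith
  · rw [Real.coe_toNNReal _ (by positivity), sphericalField, norm_smul, norm_neg,
      Real.norm_eq_abs, abs_of_pos Real.pi_pos]
    refine mul_le_mul_of_nonneg_left ?_ Real.pi_pos.le
    exact norm_integral_le_of_norm_le_const (ae_of_all _ fun ω => hM _)

end SphericalField

section Schwartz

variable {d : ℕ} (f : SchwartzMap (E d) ℂ)

theorem contDiff_norm_sq_schwartz : ContDiff ℝ 1 fun η => ‖f η‖ ^ 2 :=
  (f.smooth 1).norm_sq ℝ

theorem contDiff_gfun : ContDiff ℝ 1 (gfun f) :=
  (contDiff_norm_sq_schwartz f).smul contDiff_id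

theorem integrable_gfun : Integrable (gfun f) := by
  obtain ⟨C, hC⟩ := f.toBoundedContinuousFunction.isBounded_range.exists_norm_le
  have hC' : ∀ η, ‖f η‖ ≤ C := fun η => hC _ ⟨η, rfl⟩
  have h := (f.integrable_pow_mul volume 1).const_mul C
  refine h.mono' (contDiff_gfun f).continuous.aestronglyMeasurable (ae_of_all _ fun η => ?_)
  rw [gfun, norm_smul, norm_pow, norm_norm, pow_one, sq]
  calc ‖f η‖ * ‖f η‖ * ‖η‖ ≤ C * ‖f η‖ * ‖η‖ := by gcongr; exact hC' η
    _ = C * (‖η‖ * ‖f η‖) := by ring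

/-- The density `(s, η) ↦ s^{d-2} |f(η)|²`. -/
def sphereWeight (p : ℝ × E d) : ℝ := p.1 ^ (d - 2) * ‖f p.2‖ ^ 2

theorem contDiff_sphereWeight : ContDiff ℝ 1 (sphereWeight f) :=
  (contDiff_fst.pow _).mul ((contDiff_norm_sq_schwartz f).comp contDiff_snd)

theorem sphericalField_sphereWeight (u : E d) :
    sphericalField (sphereWeight f) u = (-2 : ℝ) • Real.pi • (1 / 2 * ‖u‖ ^ (d - 2)) •
      ∫ ω, gfun f (u + ‖u‖ • (ω : E d)) ∂(volume : Measure (E d)).toSphere := by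
  simp only [sphericalField, sphereWeight, gfun, mul_smul]
  rw [integral_smul, smul_smul, smul_smul, smul_smul, smul_smul]
  congr 1
  ring

theorem F0pt_eq_sphericalField (hd : 3 ≤ d) {u : E d} (hu : u ≠ 0) :
    F0pt f u = sphericalField (sphereWeight f) u := by
  have : Nontrivial (E d) := ⟨⟨u, 0, hu⟩⟩
  refine Tendsto.limUnder_eq ?_
  have hcoord : ∀ (i : Fin d) (r : ℝ), F0inner f r u i =
      ∫ η, Real.cos (r * (‖η‖ ^ 2 - 2 * ⟪η, u⟫)) * gfun f η i := by
    intro i r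
    have h_int : Integrable fun η => Real.cos (r * (‖η‖ ^ 2 - 2 * ⟪η, u⟫)) • gfun f η :=
      (integrable_gfun f).bdd_smul
        (φ := fun η => Real.cos (r * (‖η‖ ^ 2 - 2 * ⟪η, u⟫))) 1
        (Continuous.aestronglyMeasurable (by fun_prop))
        (ae_of_all _ fun _ => Real.abs_cos_le_one _)
    exact ((EuclideanSpace.proj (𝕜 := ℝ) i).integral_comp_comm h_int).symm
  have hgi : ∀ i, Integrable fun η => gfun f η i := fun i =>
    (EuclideanSpace.proj (𝕜 := ℝ) i).integrable_comp (integrable_gfun f)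
  have hgc : ∀ i, ContDiff ℝ 1 fun η => gfun f η i := fun i =>
    contDiff_euclidean.1 (contDiff_gfun f) i
  have hcont : Continuous fun r => F0inner f r u := by
    refine continuous_of_dominated (bound := fun η => ‖gfun f η‖)
      (fun r => ?_) (fun r => ae_of_all _ fun η => ?_) (integrable_gfun f).norm
      (ae_of_all _ fun η => by fun_prop)
    · have := (contDiff_gfun f).continuous
      exact Continuous.aestronglyMeasurable (by fun_prop)
    · rw [norm_smul]
      exact mul_le_of_le_one_left (norm_nonneg _) (Real.abs_cos_le_one _)
  have hFi : ∀ (i : Fin d) (R : ℝ), (∫ r in (0 : ℝ)..R, (-2 : ℝ) • F0inner f r u) i =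
      -2 * ∫ r in (0 : ℝ)..R, ∫ η, Real.cos (r * (‖η‖ ^ 2 - 2 * ⟪η, u⟫)) * gfun f η i := by
    intro i R
    have h := (EuclideanSpace.proj (𝕜 := ℝ) i).intervalIntegral_comp_comm
      ((hcont.const_smul (-2 : ℝ)).intervalIntegrable (μ := volume) 0 R)
    rw [← intervalIntegral.integral_const_mul]
    refine h.symm.trans ?_
    congr 1 with r
    simp [hcoord]
  have hlim : ∀ i, Tendsto (fun R : ℝ => (∫ r in (0 : ℝ)..R, (-2 : ℝ) • F0inner f r u) i) atTop
      (𝓝 (sphericalField (sphereWeight f) u i)) := by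
    intro i
    have h := (tendsto_integral_cos_sphere volume (hgc i) (hgi i) (n := d - 2)
      (by rw [finrank_euclideanSpace_fin]; omega) hu).const_mul (-2)
    have hs := (EuclideanSpace.proj (𝕜 := ℝ) i).integral_comp_comm
      (integrable_toSphere_of_continuous (V := E d)
        (φ := fun ω => gfun f (u + ‖u‖ • (ω : E d)))
        ((contDiff_gfun f).continuous.comp (by fun_prop)))
    simp only [PiLp.proj_apply] at hs
    simp only [hFi]
    rw [sphericalField_sphereWeight]
    simpa only [PiLp.smul_apply, smul_eq_mul, ← hs] using h
  exact ((PiLp.continuous_toLp 2 _).tendsto _).comp (tendsto_pi_nhds.2 hlim)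

theorem sphereWeight_nonneg (p : ℝ × E d) (hp : 0 ≤ p.1) : 0 ≤ sphereWeight f p :=
  mul_nonneg (pow_nonneg hp _) (sq_nonneg _)

theorem sphereWeight_pos {p : ℝ × E d} (hp : 0 < p.1) (hf : 0 < ‖f p.2‖) :
    0 < sphereWeight f p :=
  mul_pos (pow_pos hp _) (pow_pos hf 2)

end Schwartz

/-- for `d ≥ 3`, `ξ₀ ≠ 0`, if `min {|f(η)| : η ∈ B̄(0,2|ξ₀|)} > 0` then the
maximal solution of `ξ' = F^(0)(ξ)`, `ξ(0) = ξ₀` is defined on all of `[0,∞)` (it is the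
unique solution there), its norm is non-increasing, and `ξ(t) → 0` as `t → ∞`. -/
theorem statement12 (d : ℕ) (hd : 3 ≤ d) (f : SchwartzMap (E d) ℂ) (ξ₀ : E d) (hξ₀ : ξ₀ ≠ 0)
    (hf : 0 < sInf ((fun η => ‖f η‖) '' Metric.closedBall (0 : E d) (2 * ‖ξ₀‖))) :
    ∃ ξ : ℝ → E d, ξ 0 = ξ₀ ∧
      (∀ t ∈ Set.Ici (0 : ℝ),
        ξ t ≠ 0 ∧ HasDerivWithinAt ξ (F0pt f (ξ t)) (Set.Ici (0 : ℝ)) t) ∧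
      (∀ (T' : ℝ) (ζ : ℝ → E d), ζ 0 = ξ₀ →
        (∀ t ∈ Set.Ico (0 : ℝ) T',
          ζ t ≠ 0 ∧ HasDerivWithinAt ζ (F0pt f (ζ t)) (Set.Ici (0 : ℝ)) t) →
        ∀ t ∈ Set.Ico (0 : ℝ) T', ζ t = ξ t) ∧
      AntitoneOn (fun t => ‖ξ t‖) (Set.Ici (0 : ℝ)) ∧
      Filter.Tendsto ξ Filter.atTop (𝓝 (0 : E d)) := by
  have hR : 0 < ‖ξ₀‖ := norm_pos_iff.2 hξ₀
  have hfpos : ∀ η : E d, ‖η‖ ≤ 2 * ‖ξ₀‖ → 0 < ‖f η‖ := fun η hη =>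
    hf.trans_le (csInf_le ⟨0, by rintro _ ⟨y, -, rfl⟩; exact norm_nonneg _⟩
      ⟨η, by simpa using hη, rfl⟩)
  let χ : ContDiffBump (0 : ℝ × E d) := ⟨2 * ‖ξ₀‖, 4 * ‖ξ₀‖, by positivity, by linarith⟩
  have hχ : ∀ (s : ℝ) (η : E d), |s| ≤ 2 * ‖ξ₀‖ → ‖η‖ ≤ 2 * ‖ξ₀‖ → χ (s, η) = 1 :=
    fun s η hs hη => χ.one_of_mem_closedBall (by
      rw [mem_closedBall_zero_iff, Prod.norm_mk]
      exact max_le hs hη)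
  set w : ℝ × E d → ℝ := fun p => χ p * sphereWeight f p with hw
  have hwd : ContDiff ℝ 1 w := χ.contDiff.mul (contDiff_sphereWeight f)
  have hw0 : ∀ p, 0 ≤ p.1 → 0 ≤ w p := fun p hp =>
    mul_nonneg χ.nonneg (sphereWeight_nonneg f p hp)
  obtain ⟨K, L, hK, hL⟩ :=
    exists_lipschitzWith_sphericalField hwd (χ.hasCompactSupport.mul_right)
  have hfield : ∀ u : E d, u ≠ 0 → ‖u‖ ≤ ‖ξ₀‖ → F0pt f u = sphericalField w u := by
    intro u hu hle
    rw [F0pt_eq_sphericalField f hd hu, sphericalField, sphericalField]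
    have : ∀ ω : Metric.sphere (0 : E d) 1, χ (‖u‖, u + ‖u‖ • (ω : E d)) = 1 := fun ω =>
      hχ _ _ (by rw [abs_norm]; linarith)
        ((norm_add_norm_smul_sphere_le u ω).trans (by linarith))
    simp only [hw, this, one_mul]
  obtain ⟨ξ, h0, hξ⟩ := exists_forall_hasDerivWithinAt_Ici hK hL ξ₀
  have hanti : AntitoneOn (fun t => ‖ξ t‖) (Ici 0) :=
    antitoneOn_norm_of_inner_nonpos (convex_Ici 0) hξ
      fun t _ => inner_sphericalField_nonpos hwd.continuous hw0 (ξ t)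
  have hle : ∀ t ∈ Ici (0 : ℝ), ‖ξ t‖ ≤ ‖ξ₀‖ := fun t ht => by
    simpa only [h0] using hanti self_mem_Ici ht ht
  have hne := ne_zero_of_hasDerivWithinAt_Ici hK (sphericalField_zero w) hξ (h0 ▸ hξ₀)
  refine ⟨ξ, h0, fun t ht => ⟨hne t ht, hfield _ (hne t ht) (hle t ht) ▸ hξ t ht⟩, ?_, hanti, ?_⟩
  · intro T' ζ hζ0 hζ t ht
    have hζle : ∀ s ∈ Ico 0 T', ‖ζ s‖ ≤ ‖ξ₀‖ := fun s hs => by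
      have hζanti : AntitoneOn (fun t => ‖ζ t‖) (Ico 0 T') :=
        antitoneOn_norm_of_inner_nonpos (convex_Ico 0 T')
          (fun s hs => (hζ s hs).2.mono Ico_subset_Ici_self) fun s hs => by
            rw [F0pt_eq_sphericalField f hd (hζ s hs).1]
            exact inner_sphericalField_nonpos (contDiff_sphereWeight f).continuous
              (sphereWeight_nonneg f) _
      simpa only [hζ0] using hζanti ⟨le_rfl, hs.1.trans_lt hs.2⟩ hs hs.1
    have hζ' : ∀ s ∈ Icc 0 t, HasDerivWithinAt ζ (sphericalField w (ζ s)) (Ici 0) s := by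
      intro s hs
      have hs' : s ∈ Ico 0 T' := ⟨hs.1, hs.2.trans_lt ht.2⟩
      rw [← hfield _ (hζ s hs').1 (hζle s hs')]
      exact (hζ s hs').2
    exact ODE_solution_unique (v := fun _ => sphericalField w) (fun _ => hK)
      (fun s hs => (hζ' s hs).continuousWithinAt.mono Icc_subset_Ici_self)
      (fun s hs => (hζ' s ⟨hs.1, hs.2.le⟩).mono (Ici_subset_Ici.2 hs.1))
      (fun s hs => (hξ s hs.1).continuousWithinAt.mono Icc_subset_Ici_self)
      (fun s hs => (hξ s hs.1).mono (Ici_subset_Ici.2 hs.1))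
      (hζ0.trans h0.symm) ⟨ht.1, le_rfl⟩
  · refine tendsto_zero_of_inner_neg hK.continuous hξ hanti fun x hx hxle => ?_
    rw [h0] at hxle
    have h2x : ‖(2 : ℝ) • x‖ ≤ 2 * ‖ξ₀‖ := by
      rw [norm_smul, Real.norm_two]
      linarith
    refine inner_sphericalField_neg hwd.continuous hw0 hx ?_
    rw [hw]
    dsimp only
    rw [hχ _ _ (by rw [abs_norm]; linarith) h2x, one_mul]
    exact sphereWeight_pos f (norm_pos_iff.2 hx) (hfpos _ h2x)
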